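/- arXiv:1808.10194 — 3 statements merged into one kernel-verified Lean document; each statement's English description precedes it below -/
import Mathlib

section
/- Let R be a commutative ring and let B be an ideal of R satisfying B*X = B ⊓ X for every ideal X of R. Then for all ideals A and C of R, A*(B ⊓ C) = (A*B) ⊓ (A*C). -/
/-- If `B` is an ideal of a commutative ring `R` satisfying `B*X = B ⊓ X` for every
ideal `X`, then `A*(B ⊓ C) = (A*B) ⊓ (A*C)` for all ideals `A, C` of `R`. -/
theorem stmt_4 (R : Type*) [CommRing R] (B : Ideal R) (hB : ∀ X : Ideal R, B * X = B ⊓ X)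
    (A C : Ideal R) : A * (B ⊓ C) = (A * B) ⊓ (A * C) := by
  rw [← hB C, mul_left_comm, hB (A * C), mul_comm A B, hB A, inf_assoc,
    inf_eq_right.mpr (Ideal.mul_le_left : A * C ≤ A)]
end

section
/- Let R be a commutative ring in which ideal multiplication distributes over intersection, i.e. X*(Y ⊓ Z) = (X*Y) ⊓ (X*Z) for all ideals X, Y, Z of R. Then for all ideals A and B of R, (A + B)*(A ⊓ B) = A*B. -/
/-- In a commutative ring `R` whose ideal multiplication distributes over intersection,
`(A + B)*(A ⊓ B) = A*B` holds for all ideals `A, B`: the ideal version of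
`gcd(a,b)·lcm(a,b) = a·b`. -/
theorem stmt_5 (R : Type*) [CommRing R]
    (h : ∀ X Y Z : Ideal R, X * (Y ⊓ Z) = (X * Y) ⊓ (X * Z))
    (A B : Ideal R) : (A + B) * (A ⊓ B) = A * B := by
  apply le_antisymm
  · rw [add_mul, Submodule.add_eq_sup]
    refine sup_le (Ideal.mul_mono_right inf_le_right) ?_
    rw [mul_comm A B]
    exact Ideal.mul_mono_right inf_le_left
  · rw [h, Submodule.add_eq_sup]
    refine le_inf ?_ (Ideal.mul_mono_left le_sup_left)
    rw [mul_comm A B]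
    exact Ideal.mul_mono_left le_sup_right
end

section
/- Let R be a commutative ring and P a prime ideal of R such that every nonzero ideal I of R whose radical equals P is of the form P^m for some integer m ≥ 1. Then for every integer n ≥ 1 there is no ideal strictly between consecutive powers of P: if A is an ideal with P^(n+1) ⊆ A ⊆ P^n, then A = P^(n+1) or A = P^n. -/
/-- Let `P` be a prime ideal of a commutative ring `R` such that every nonzero ideal
whose radical is `P` is a power `P^m` with `m ≥ 1`. Then for every `n ≥ 1` there is no
ideal strictly between `P^(n+1)` and `P^n`. -/
theorem stmt_7 (R : Type*) [CommRing R] (P : Ideal R) (hP : P.IsPrime)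
    (h : ∀ I : Ideal R, I ≠ ⊥ → I.radical = P → ∃ m : ℕ, 1 ≤ m ∧ I = P ^ m)
    (n : ℕ) (hn : 1 ≤ n) (A : Ideal R) (h1 : P ^ (n + 1) ≤ A) (h2 : A ≤ P ^ n) :
    A = P ^ (n + 1) ∨ A = P ^ n := by
  by_cases hA : A = ⊥
  · left
    subst hA
    exact (le_bot_iff.mp h1).symm
  · have hr : A.radical = P := by
      apply le_antisymm
      · have := Ideal.radical_mono h2
        rwa [Ideal.radical_pow P (by omega), hP.radical] at this
      · have := Ideal.radical_mono h1
        rwa [Ideal.radical_pow P (by omega), hP.radical] at this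
    obtain ⟨m, -, rfl⟩ := h A hA hr
    rcases Nat.lt_or_ge n m with hm | hm
    · exact Or.inl (le_antisymm (Ideal.pow_le_pow_right hm) h1)
    · exact Or.inr (le_antisymm h2 (Ideal.pow_le_pow_right hm))
end
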